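/- Fixed points of the safe and risky Bellman operators: consider a balanced MDP and let α ∈ (0,1). For mode ∈ {safe, risky}, there exists a unique Q₁^mode : X×A → ℝ such that Q₁^mode = T^mode_α Q₁^mode. -/

import Mathlib

open MeasureTheory ProbabilityTheory Finset Set

noncomputable section

/-- Quantile (generalized inverse distribution) function of a measure on `ℝ`. -/
def quantileFn (ν : Measure ℝ) (τ : ℝ) : ℝ :=
  sInf {z : ℝ | τ ≤ cdf ν z}

/-- Left average value-at-risk at level `α`. -/
def avarLeft (α : ℝ) (ν : Measure ℝ) : ℝ :=
  (1 / α) * ∫ τ in (0:ℝ)..α, quantileFn ν τ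

/-- Right average value-at-risk at level `1 - α`. -/
def avarRight (α : ℝ) (ν : Measure ℝ) : ℝ :=
  (1 / (1 - α)) * ∫ τ in α..(1:ℝ), quantileFn ν τ

/-- A measure on `ℝ` with bounded support. -/
def HasBoundedSupport (ν : Measure ℝ) : Prop :=
  ∃ a b : ℝ, ν (Set.Icc a b)ᶜ = 0

/-- Finite Markov decision process with fixed state and action spaces. -/
structure MDP (X A : Type) [Fintype X] [Fintype A] where
  P : X → A → X → ℝ
  r : X → A → X → ℝ
  γ : ℝ
  P_nonneg : ∀ x a x', 0 ≤ P x a x'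
  P_sum_one : ∀ x a, ∑ x', P x a x' = 1
  γ_nonneg : 0 ≤ γ
  γ_lt_one : γ < 1

variable {X A : Type} [Fintype X] [Fintype A]

/-- A stationary Markovian policy. -/
def IsPolicy (π : X → A → ℝ) : Prop :=
  (∀ x a, 0 ≤ π x a) ∧ ∀ x, ∑ a, π x a = 1

/-- The discrete measure `(T^π D_{α,Q})^{(x,a)}`. -/
def diatomicMeasure (M : MDP X A) (α : ℝ) (π : X → A → ℝ)
    (Q : X → A → ℝ × ℝ) (x : X) (a : A) : Measure ℝ :=
  ∑ x' : X, ∑ a' : A, ENNReal.ofReal (M.P x a x' * π x' a') •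
    (ENNReal.ofReal α • Measure.dirac (M.r x a x' + M.γ * (Q x' a').1)
      + ENNReal.ofReal (1 - α) • Measure.dirac (M.r x a x' + M.γ * (Q x' a').2))

/-- The diatomic Bellman operator `T^π_α`. -/
def diatomicT (M : MDP X A) (α : ℝ) (π : X → A → ℝ)
    (Q : X → A → ℝ × ℝ) : X → A → ℝ × ℝ :=
  fun x a => (avarLeft α (diatomicMeasure M α π Q x a),
              avarRight α (diatomicMeasure M α π Q x a))

variable [Nonempty A]

/-- The second component `Q₂` determined by `Q₁` in a balanced MDP. -/
def Q2of (α : ℝ) (Vstar : X → ℝ) (Q1 : X → A → ℝ) : X → A → ℝ :=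
  fun x a => (Vstar x - α * Q1 x a) / (1 - α)

/-- The MDP is balanced: `Q^*(x,a) = V^*(x)` for all `(x,a)`, i.e. `V^*` solves the
Bellman optimality equation with all actions optimal. -/
def IsBalanced (M : MDP X A) (Vstar : X → ℝ) : Prop :=
  ∀ x a, Vstar x = ∑ x', M.P x a x' * (M.r x a x' + M.γ * Vstar x')

/-- The discrete measure appearing in the safe Bellman operator. -/
def safeMeasure (M : MDP X A) (α : ℝ) (Vstar : X → ℝ) (Q1 : X → A → ℝ)
    (x : X) (a : A) : Measure ℝ :=
  ∑ x' : X, ENNReal.ofReal (M.P x a x') •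
    (ENNReal.ofReal α • Measure.dirac (M.r x a x' + M.γ * ⨆ a', Q1 x' a')
      + ENNReal.ofReal (1 - α) •
          Measure.dirac (M.r x a x' + M.γ * ⨅ a', Q2of α Vstar Q1 x' a'))

/-- The discrete measure appearing in the risky Bellman operator. -/
def riskyMeasure (M : MDP X A) (α : ℝ) (Vstar : X → ℝ) (Q1 : X → A → ℝ)
    (x : X) (a : A) : Measure ℝ :=
  ∑ x' : X, ENNReal.ofReal (M.P x a x') •
    (ENNReal.ofReal α • Measure.dirac (M.r x a x' + M.γ * ⨅ a', Q1 x' a')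
      + ENNReal.ofReal (1 - α) •
          Measure.dirac (M.r x a x' + M.γ * ⨆ a', Q2of α Vstar Q1 x' a'))

/-- The safe Bellman operator `T^safe_α`. -/
def Tsafe (M : MDP X A) (α : ℝ) (Vstar : X → ℝ) (Q1 : X → A → ℝ) : X → A → ℝ :=
  fun x a => avarLeft α (safeMeasure M α Vstar Q1 x a)

/-- The risky Bellman operator `T^risky_α`. -/
def Trisky (M : MDP X A) (α : ℝ) (Vstar : X → ℝ) (Q1 : X → A → ℝ) : X → A → ℝ :=
  fun x a => avarLeft α (riskyMeasure M α Vstar Q1 x a)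

/-- Galois connection between the quantile function and the cumulative distribution function. -/
lemma quantileFn_le_iff (ν : Measure ℝ) {τ : ℝ} (hτ : τ ∈ Set.Ioo (0:ℝ) 1) (z : ℝ) :
    quantileFn ν τ ≤ z ↔ τ ≤ cdf ν z := by
  have hne : {z : ℝ | τ ≤ cdf ν z}.Nonempty :=
    (((tendsto_cdf_atTop ν).eventually (lt_mem_nhds hτ.2)).exists).imp fun _ h => h.le
  have hbdd : BddBelow {z : ℝ | τ ≤ cdf ν z} := by
    obtain ⟨b, hb⟩ := ((tendsto_cdf_atBot ν).eventually (gt_mem_nhds hτ.1)).exists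
    refine ⟨b, fun y hy => ?_⟩
    by_contra! hlt
    exact absurd (hy.trans (monotone_cdf ν hlt.le)) (not_le.mpr hb)
  constructor
  · intro h
    refine le_trans ?_ (monotone_cdf ν h)
    have hright := ((cdf ν).right_continuous (quantileFn ν τ)).tendsto.mono_left
      (nhdsWithin_mono _ Set.Ioi_subset_Ici_self)
    refine ge_of_tendsto hright ?_
    filter_upwards [self_mem_nhdsWithin] with y hy
    obtain ⟨w, hw, hwy⟩ := exists_lt_of_csInf_lt hne hy
    exact le_trans hw (monotone_cdf ν hwy.le)
  · exact fun h => csInf_le hbdd h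

lemma monotoneOn_quantileFn (ν : Measure ℝ) : MonotoneOn (quantileFn ν) (Set.Ioo 0 1) :=
  fun _ hs _ ht hst =>
    (quantileFn_le_iff ν hs _).2 (hst.trans ((quantileFn_le_iff ν ht _).1 le_rfl))

lemma aemeasurable_quantileFn (ν : Measure ℝ) :
    AEMeasurable (quantileFn ν) (volume.restrict (Set.Ioo 0 1)) :=
  aemeasurable_restrict_of_monotoneOn measurableSet_Ioo (monotoneOn_quantileFn ν)

/-- The quantile function of a probability measure transports the uniform law to the measure. -/
lemma map_quantileFn (ν : Measure ℝ) [IsProbabilityMeasure ν] :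
    (volume.restrict (Set.Ioo (0:ℝ) 1)).map (quantileFn ν) = ν := by
  symm
  refine Measure.ext_of_Iic _ _ fun z => ?_
  rw [Measure.map_apply_of_aemeasurable (aemeasurable_quantileFn ν) measurableSet_Iic,
    Measure.restrict_apply' measurableSet_Ioo, ← ofReal_cdf ν z]
  have hc := cdf_le_one ν z
  apply le_antisymm
  · calc ENNReal.ofReal (cdf ν z) = volume (Set.Ioo 0 (cdf ν z)) := by simp
      _ ≤ volume (quantileFn ν ⁻¹' Set.Iic z ∩ Set.Ioo 0 1) := measure_mono fun τ hτ =>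
        have h : τ ∈ Set.Ioo (0:ℝ) 1 := ⟨hτ.1, hτ.2.trans_le hc⟩
        ⟨(quantileFn_le_iff ν h z).2 hτ.2.le, h⟩
  · calc _ ≤ volume (Set.Ioc 0 (cdf ν z)) := measure_mono fun τ hτ =>
        ⟨hτ.2.1, (quantileFn_le_iff ν hτ.2 z).1 hτ.1⟩
      _ = ENNReal.ofReal (cdf ν z) := by simp

lemma integrableOn_quantileFn (ν : Measure ℝ) [IsProbabilityMeasure ν]
    (hν : Integrable (fun y => y) ν) : IntegrableOn (quantileFn ν) (Set.Ioo 0 1) := by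
  have h := hν
  rw [← map_quantileFn ν] at h
  exact h.comp_aemeasurable (aemeasurable_quantileFn ν)

lemma integral_shortfall_eq (ν : Measure ℝ) [IsProbabilityMeasure ν] (z : ℝ) :
    ∫ y, max (z - y) 0 ∂ν = ∫ τ in Set.Ioo (0:ℝ) 1, max (z - quantileFn ν τ) 0 := by
  conv_lhs => rw [← map_quantileFn ν]
  exact integral_map (aemeasurable_quantileFn ν)
    (by fun_prop : Continuous fun y : ℝ => max (z - y) 0).aestronglyMeasurable

section Shortfall

variable {α : ℝ} (ν : Measure ℝ) [IsProbabilityMeasure ν]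

lemma integrableOn_shortfall (hν : Integrable (fun y => y) ν) (z : ℝ) :
    IntegrableOn (fun τ => max (z - quantileFn ν τ) 0) (Set.Ioo 0 1) :=
  (Integrable.sub (integrable_const z) (integrableOn_quantileFn ν hν)).pos_part

lemma intervalIntegral_quantileFn_eq (hα : α ∈ Set.Ioo (0:ℝ) 1)
    (hν : Integrable (fun y => y) ν) (z : ℝ) :
    ∫ τ in (0:ℝ)..α, quantileFn ν τ
      = α * z - ∫ τ in Set.Ioc (0:ℝ) α, (z - quantileFn ν τ) := by
  have hi : IntegrableOn (quantileFn ν) (Set.Ioc 0 α) :=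
    (integrableOn_quantileFn ν hν).mono_set fun _ h => ⟨h.1, h.2.trans_lt hα.2⟩
  rw [intervalIntegral.integral_of_le hα.1.le, integral_sub (integrable_const z) hi]
  simp [hα.1.le]

/-- Every threshold gives a lower bound for the integrated quantile function. -/
lemma sub_shortfall_le_integral_quantileFn (hα : α ∈ Set.Ioo (0:ℝ) 1)
    (hν : Integrable (fun y => y) ν) (z : ℝ) :
    α * z - ∫ y, max (z - y) 0 ∂ν ≤ ∫ τ in (0:ℝ)..α, quantileFn ν τ := by
  have hsub : Set.Ioc (0:ℝ) α ⊆ Set.Ioo 0 1 := fun _ h => ⟨h.1, h.2.trans_lt hα.2⟩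
  have hs := integrableOn_shortfall ν hν z
  rw [intervalIntegral_quantileFn_eq ν hα hν z, integral_shortfall_eq ν z]
  have h1 : ∫ τ in Set.Ioc (0:ℝ) α, (z - quantileFn ν τ)
      ≤ ∫ τ in Set.Ioc (0:ℝ) α, max (z - quantileFn ν τ) 0 :=
    integral_mono
      (Integrable.sub (integrable_const z) ((integrableOn_quantileFn ν hν).mono_set hsub))
      (hs.mono_set hsub) fun _ => le_max_left _ _
  have h2 : ∫ τ in Set.Ioc (0:ℝ) α, max (z - quantileFn ν τ) 0
      ≤ ∫ τ in Set.Ioo (0:ℝ) 1, max (z - quantileFn ν τ) 0 :=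
    setIntegral_mono_set hs (Filter.Eventually.of_forall fun _ => le_max_right _ _)
      hsub.eventuallyLE
  linarith

/-- The `α`-quantile attains the lower bound `sub_shortfall_le_integral_quantileFn`. -/
lemma integral_quantileFn_eq_sub_shortfall (hα : α ∈ Set.Ioo (0:ℝ) 1)
    (hν : Integrable (fun y => y) ν) :
    ∫ τ in (0:ℝ)..α, quantileFn ν τ
      = α * quantileFn ν α - ∫ y, max (quantileFn ν α - y) 0 ∂ν := by
  have hsub : Set.Ioc (0:ℝ) α ⊆ Set.Ioo 0 1 := fun _ h => ⟨h.1, h.2.trans_lt hα.2⟩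
  rw [intervalIntegral_quantileFn_eq ν hα hν (quantileFn ν α), integral_shortfall_eq ν]
  congr 1
  rw [setIntegral_eq_of_subset_of_forall_sdiff_eq_zero measurableSet_Ioo hsub]
  · refine setIntegral_congr_fun measurableSet_Ioc fun τ hτ => ?_
    exact (max_eq_left (sub_nonneg.2 (monotoneOn_quantileFn ν (hsub hτ) hα hτ.2))).symm
  · rintro τ ⟨hτ, hτ'⟩
    have hατ : α ≤ τ := by
      by_contra! h
      exact hτ' ⟨hτ.1, h.le⟩
    exact max_eq_right (sub_nonpos.2 (monotoneOn_quantileFn ν hα hτ hατ))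

end Shortfall

/-- Uniformly close expected shortfalls give close left average values-at-risk. -/
lemma avarLeft_le_add_of_shortfall_le {α : ℝ} (hα : α ∈ Set.Ioo (0:ℝ) 1)
    (ν ρ : Measure ℝ) [IsProbabilityMeasure ν] [IsProbabilityMeasure ρ]
    (hν : Integrable (fun y => y) ν) (hρ : Integrable (fun y => y) ρ) {c : ℝ}
    (h : ∀ z, ∫ y, max (z - y) 0 ∂ρ ≤ ∫ y, max (z - y) 0 ∂ν + α * c) :
    avarLeft α ν ≤ avarLeft α ρ + c := by
  have h1 := integral_quantileFn_eq_sub_shortfall ν hα hν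
  have h2 := sub_shortfall_le_integral_quantileFn ρ hα hρ (quantileFn ν α)
  have h3 := h (quantileFn ν α)
  have hα0 := hα.1
  have key : ∫ τ in (0:ℝ)..α, quantileFn ν τ ≤ (∫ τ in (0:ℝ)..α, quantileFn ρ τ) + α * c := by
    linarith
  calc avarLeft α ν ≤ 1 / α * ((∫ τ in (0:ℝ)..α, quantileFn ρ τ) + α * c) :=
        mul_le_mul_of_nonneg_left key (by positivity)
    _ = avarLeft α ρ + c := by
        unfold avarLeft
        field_simp

/-- The mixture over `i`, with weights `p i`, of the two-point laws giving mass `α` to `u i` and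
mass `1 - α` to `v i`. -/
def diatomicMixture {ι : Type} [Fintype ι] (α : ℝ) (p u v : ι → ℝ) : Measure ℝ :=
  ∑ i, ENNReal.ofReal (p i) •
    (ENNReal.ofReal α • Measure.dirac (u i) + ENNReal.ofReal (1 - α) • Measure.dirac (v i))

section Mixture

variable {ι : Type} [Fintype ι] {α : ℝ} {p : ι → ℝ}

lemma isProbabilityMeasure_diatomicMixture (hα : α ∈ Set.Ioo (0:ℝ) 1) (hp : ∀ i, 0 ≤ p i)
    (hp1 : ∑ i, p i = 1) (u v : ι → ℝ) : IsProbabilityMeasure (diatomicMixture α p u v) := by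
  constructor
  have h : ENNReal.ofReal α + ENNReal.ofReal (1 - α) = 1 := by
    rw [← ENNReal.ofReal_add hα.1.le (by linarith [hα.2])]
    simp
  simp [diatomicMixture, ← mul_add, h, ← ENNReal.ofReal_sum_of_nonneg (fun i _ => hp i), hp1]

lemma integrable_diatomicMixture (u v : ι → ℝ) (f : ℝ → ℝ) :
    Integrable f (diatomicMixture α p u v) :=
  integrable_finsetSum_measure.2 fun _ _ =>
    (((integrable_dirac (by simp)).smul_measure ENNReal.ofReal_ne_top).add_measure
      ((integrable_dirac (by simp)).smul_measure ENNReal.ofReal_ne_top)).smul_measure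
        ENNReal.ofReal_ne_top

lemma integral_diatomicMixture (hα : α ∈ Set.Ioo (0:ℝ) 1) (hp : ∀ i, 0 ≤ p i)
    (u v : ι → ℝ) (f : ℝ → ℝ) :
    ∫ y, f y ∂(diatomicMixture α p u v) = ∑ i, p i * (α * f (u i) + (1 - α) * f (v i)) := by
  have hd : ∀ (c w : ℝ), Integrable f (ENNReal.ofReal c • Measure.dirac w) := fun c w =>
    (integrable_dirac (by simp)).smul_measure ENNReal.ofReal_ne_top
  unfold diatomicMixture
  rw [integral_finsetSum_measure fun i _ =>
    ((hd _ _).add_measure (hd _ _)).smul_measure ENNReal.ofReal_ne_top]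
  refine Finset.sum_congr rfl fun i _ => ?_
  rw [integral_smul_measure, integral_add_measure (hd _ _) (hd _ _), integral_smul_measure,
    integral_smul_measure, integral_dirac, integral_dirac, ENNReal.toReal_ofReal (hp i),
    ENNReal.toReal_ofReal hα.1.le, ENNReal.toReal_ofReal (by linarith [hα.2])]
  simp

end Mixture

/-- Moving the lower atom by `γ * d` and compensating with the upper atom, so that the mean is
preserved, changes the expected shortfall of a two-point law by at most `α * (γ * |d|)`. -/
lemma diatomic_shortfall_le {α γ c : ℝ} (hα : α ∈ Set.Ioo (0:ℝ) 1) (hγ : 0 ≤ γ)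
    {m n V : ℝ} (h : |m - n| ≤ c) (r z : ℝ) :
    α * max (z - (r + γ * n)) 0 + (1 - α) * max (z - (r + γ * ((V - α * n) / (1 - α)))) 0
      ≤ α * max (z - (r + γ * m)) 0 + (1 - α) * max (z - (r + γ * ((V - α * m) / (1 - α)))) 0
        + α * (γ * c) := by
  obtain ⟨hα0, hα1⟩ := hα
  have hβ : 0 < 1 - α := by linarith
  obtain ⟨hl, hu⟩ := abs_le.1 h
  have lip : ∀ {a b e : ℝ}, a ≤ b + e → 0 ≤ e → max a 0 ≤ max b 0 + e := fun {a b e} hab he =>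
    max_le (hab.trans (by gcongr; exact le_max_left _ _))
      (by have := le_max_right b 0; linarith)
  have hscale : ∀ w : ℝ, (1 - α) * max (z - (r + γ * ((V - α * w) / (1 - α)))) 0
      = max ((1 - α) * (z - r) - γ * (V - α * w)) 0 := fun w => by
    rw [mul_max_of_nonneg _ _ hβ.le, mul_zero]
    congr 1
    field_simp
    ring
  have hscale' : ∀ w : ℝ, α * max (z - (r + γ * w)) 0 = max (α * (z - r) - α * γ * w) 0 :=
    fun w => by
      rw [mul_max_of_nonneg _ _ hα0.le, mul_zero]
      congr 1
      ring
  simp only [hscale, hscale']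
  have hk : 0 ≤ α * γ := by positivity
  have h1 : α * γ * (m - n) ≤ α * γ * c := mul_le_mul_of_nonneg_left hu hk
  have h2 : α * γ * -c ≤ α * γ * (m - n) := mul_le_mul_of_nonneg_left hl hk
  rcases le_total n m with hnm | hnm
  · have h3 : 0 ≤ α * γ * (m - n) := mul_nonneg hk (by linarith)
    have e1 := lip (a := α * (z - r) - α * γ * n) (b := α * (z - r) - α * γ * m)
      (e := α * (γ * c)) (by linarith) (by linarith)
    have e2 := lip (a := (1 - α) * (z - r) - γ * (V - α * n))
      (b := (1 - α) * (z - r) - γ * (V - α * m)) (e := 0) (by linarith) le_rfl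
    linarith
  · have h3 : α * γ * (m - n) ≤ 0 := mul_nonpos_of_nonneg_of_nonpos hk (by linarith)
    have e1 := lip (a := α * (z - r) - α * γ * n) (b := α * (z - r) - α * γ * m)
      (e := 0) (by linarith) le_rfl
    have e2 := lip (a := (1 - α) * (z - r) - γ * (V - α * n))
      (b := (1 - α) * (z - r) - γ * (V - α * m)) (e := α * (γ * c)) (by linarith) (by linarith)
    linarith

lemma avarLeft_diatomicMixture_le {ι : Type} [Fintype ι] {α γ c : ℝ} {p : ι → ℝ}
    (hα : α ∈ Set.Ioo (0:ℝ) 1) (hγ : 0 ≤ γ) (hp : ∀ i, 0 ≤ p i) (hp1 : ∑ i, p i = 1)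
    (r V : ι → ℝ) {m n : ι → ℝ} (h : ∀ i, |m i - n i| ≤ c) :
    avarLeft α (diatomicMixture α p (fun i => r i + γ * m i)
        fun i => r i + γ * ((V i - α * m i) / (1 - α)))
      ≤ avarLeft α (diatomicMixture α p (fun i => r i + γ * n i)
        fun i => r i + γ * ((V i - α * n i) / (1 - α))) + γ * c := by
  have := isProbabilityMeasure_diatomicMixture hα hp hp1
  refine avarLeft_le_add_of_shortfall_le hα _ _ (integrable_diatomicMixture _ _ _)
    (integrable_diatomicMixture _ _ _) fun z => ?_
  rw [integral_diatomicMixture hα hp, integral_diatomicMixture hα hp]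
  calc _ ≤ ∑ i, p i * ((α * max (z - (r i + γ * m i)) 0
          + (1 - α) * max (z - (r i + γ * ((V i - α * m i) / (1 - α)))) 0) + α * (γ * c)) :=
        Finset.sum_le_sum fun i _ =>
          mul_le_mul_of_nonneg_left (diatomic_shortfall_le hα hγ (h i) _ _) (hp i)
    _ = _ := by
        simp only [mul_add _ _ (α * (γ * c)), Finset.sum_add_distrib, ← Finset.sum_mul, hp1,
          one_mul]

/-- A Bellman-type operator driven by a state-value selector that is nonexpansive in the uniform
norm has a unique fixed point. -/
lemma existsUnique_fixedPoint_of_nonexpansive {S B : Type} [Fintype S] [Fintype B]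
    (M : MDP S B) {α : ℝ} (hα : α ∈ Set.Ioo (0:ℝ) 1) (V : S → ℝ)
    (T : (S → B → ℝ) → S → B → ℝ) (m : (S → B → ℝ) → S → ℝ)
    (hm : ∀ Q Q' s, |m Q s - m Q' s| ≤ dist Q Q')
    (hT : ∀ Q s b, T Q s b = avarLeft α (diatomicMixture α (M.P s b)
      (fun s' => M.r s b s' + M.γ * m Q s')
      fun s' => M.r s b s' + M.γ * ((V s' - α * m Q s') / (1 - α)))) :
    ∃! Q : S → B → ℝ, T Q = Q := by
  have hle : ∀ Q Q' s b, T Q s b ≤ T Q' s b + M.γ * dist Q Q' := fun Q Q' s b => by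
    rw [hT, hT]
    exact avarLeft_diatomicMixture_le hα M.γ_nonneg (M.P_nonneg s b) (M.P_sum_one s b)
      (M.r s b) V (hm Q Q')
  have hc : ContractingWith ⟨M.γ, M.γ_nonneg⟩ T := by
    refine ⟨M.γ_lt_one, LipschitzWith.of_dist_le_mul fun Q Q' => ?_⟩
    have h0 : 0 ≤ M.γ * dist Q Q' := mul_nonneg M.γ_nonneg dist_nonneg
    refine (dist_pi_le_iff h0).2 fun s => (dist_pi_le_iff h0).2 fun b => ?_
    rw [Real.dist_eq, abs_sub_le_iff]
    have h1 := hle Q Q' s b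
    have h2 := hle Q' Q s b
    rw [dist_comm Q' Q] at h2
    constructor <;> linarith
  exact ⟨ContractingWith.fixedPoint T hc, hc.fixedPoint_isFixedPt,
    fun _ hQ => hc.fixedPoint_unique hQ⟩

section Extrema

variable {B : Type} [Finite B] [Nonempty B]

lemma ciSup_antitone_affine {α : ℝ} (hα : α ∈ Set.Ioo (0:ℝ) 1) (V : ℝ) (f : B → ℝ) :
    ⨆ b, (V - α * f b) / (1 - α) = (V - α * ⨅ b, f b) / (1 - α) := by
  have hβ : 0 ≤ 1 - α := by linarith [hα.2]
  have hα0 := hα.1.le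
  obtain ⟨b, hb⟩ := exists_eq_ciInf_of_finite (f := f)
  refine le_antisymm (ciSup_le fun b' => ?_) ?_
  · gcongr
    exact ciInf_le (Set.finite_range f).bddBelow b'
  · rw [← hb]
    exact le_ciSup (f := fun b => (V - α * f b) / (1 - α)) (Set.finite_range _).bddAbove b

lemma ciInf_antitone_affine {α : ℝ} (hα : α ∈ Set.Ioo (0:ℝ) 1) (V : ℝ) (f : B → ℝ) :
    ⨅ b, (V - α * f b) / (1 - α) = (V - α * ⨆ b, f b) / (1 - α) := by
  have hβ : 0 ≤ 1 - α := by linarith [hα.2]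
  have hα0 := hα.1.le
  obtain ⟨b, hb⟩ := exists_eq_ciSup_of_finite (f := f)
  refine le_antisymm ?_ (le_ciInf fun b' => ?_)
  · rw [← hb]
    exact ciInf_le (f := fun b => (V - α * f b) / (1 - α)) (Set.finite_range _).bddBelow b
  · gcongr
    exact le_ciSup (Set.finite_range f).bddAbove b'

lemma abs_ciSup_sub_ciSup_le {f g : B → ℝ} {c : ℝ} (h : ∀ b, |f b - g b| ≤ c) :
    |(⨆ b, f b) - ⨆ b, g b| ≤ c := by
  rw [abs_sub_le_iff, sub_le_iff_le_add, sub_le_iff_le_add]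
  constructor <;> refine ciSup_le fun b => ?_
  · linarith [(abs_le.1 (h b)).2, le_ciSup (Set.finite_range g).bddAbove b]
  · linarith [(abs_le.1 (h b)).1, le_ciSup (Set.finite_range f).bddAbove b]

lemma abs_ciInf_sub_ciInf_le {f g : B → ℝ} {c : ℝ} (h : ∀ b, |f b - g b| ≤ c) :
    |(⨅ b, f b) - ⨅ b, g b| ≤ c := by
  rw [abs_sub_le_iff, sub_le_comm, sub_le_comm (a := ⨅ b, g b)]
  constructor <;> refine le_ciInf fun b => ?_
  · linarith [(abs_le.1 (h b)).2, ciInf_le (Set.finite_range f).bddBelow b]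
  · linarith [(abs_le.1 (h b)).1, ciInf_le (Set.finite_range g).bddBelow b]

end Extrema

lemma abs_sub_apply_le_dist {S B : Type} [Fintype S] [Fintype B] (Q Q' : S → B → ℝ)
    (s : S) (b : B) : |Q s b - Q' s b| ≤ dist Q Q' := by
  rw [← Real.dist_eq]
  exact (dist_le_pi_dist (Q s) (Q' s) b).trans (dist_le_pi_dist Q Q' s)

theorem stmt16 (M : MDP X A) (α : ℝ) (hα : α ∈ Set.Ioo (0:ℝ) 1)
    (Vstar : X → ℝ) (hbal : IsBalanced M Vstar) :
    (∃! Q1 : X → A → ℝ, Tsafe M α Vstar Q1 = Q1) ∧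
    (∃! Q1 : X → A → ℝ, Trisky M α Vstar Q1 = Q1) := by
  constructor
  · refine existsUnique_fixedPoint_of_nonexpansive M hα Vstar _ (fun Q x => ⨆ a, Q x a)
      (fun Q Q' x => abs_ciSup_sub_ciSup_le (abs_sub_apply_le_dist Q Q' x)) fun Q x a => ?_
    simp only [Tsafe, safeMeasure, Q2of, ciInf_antitone_affine hα, diatomicMixture]
  · refine existsUnique_fixedPoint_of_nonexpansive M hα Vstar _ (fun Q x => ⨅ a, Q x a)
      (fun Q Q' x => abs_ciInf_sub_ciInf_le (abs_sub_apply_le_dist Q Q' x)) fun Q x a => ?_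
    simp only [Trisky, riskyMeasure, Q2of, ciSup_antitone_affine hα, diatomicMixture]

end
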